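/- Let N be a Z^n-module with all components finite-dimensional over k. If φ : F → E is a finite flange presentation of N, where F is a finite direct sum of upset modules k[a + Zτ′ + N^n] and E is a finite direct sum of downset modules k[b + Zτ − N^n] and image(φ) ≅ N, then the Matlis dual homomorphism φ^∨ : E^∨ → F^∨ is a finite flange presentation of the Matlis dual N^∨: E^∨ is a finite direct sum of upset modules of the form k[a′ + Zτ + N^n], F^∨ is a finite direct sum of downset modules of the form k[b′ + Zτ′ − N^n], and image(φ^∨) ≅ N^∨. Consequently N admits a finite flange presentation if and only if N^∨ does. -/

import Mathlib

/-- The component of the indicator module `k[S]` in degree `q`: the field `k`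
(as the full submodule of itself) if `q ∈ S`, and `0` otherwise. -/
noncomputable def cmpt (k : Type) [Field k] {Q : Type} (S : Set Q) (q : Q) : Submodule k k :=
  haveI := Classical.dec (q ∈ S)
  if q ∈ S then ⊤ else ⊥

/-- The structure map of the indicator module `k[S]` for `q ≤ q'`:
the identity of `k` when `q, q' ∈ S`, and `0` otherwise. -/
noncomputable def stMap (k : Type) [Field k] {Q : Type} [PartialOrder Q] (S : Set Q)
    {q q' : Q} (h : q ≤ q') : ↥(cmpt k S q) →ₗ[k] ↥(cmpt k S q') :=
  haveI := Classical.dec (q ∈ S ∧ q' ∈ S)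
  if hq : q ∈ S ∧ q' ∈ S then
    Submodule.inclusion (by simp [cmpt, hq.1, hq.2])
  else 0

/-- The space of `Q`-module homomorphisms `k[S] → k[T]` between indicator modules:
families of linear maps in each degree commuting with the structure maps. -/
noncomputable def HomQ (k : Type) [Field k] {Q : Type} [PartialOrder Q] (S T : Set Q) :
    Submodule k (∀ q : Q, ↥(cmpt k S q) →ₗ[k] ↥(cmpt k T q)) where
  carrier := {φ | ∀ (q q' : Q) (h : q ≤ q'), stMap k T h ∘ₗ φ q = φ q' ∘ₗ stMap k S h}
  add_mem' := by
    intro a b ha hb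
    simp only [Set.mem_setOf_eq] at ha hb ⊢
    intro q q' h
    ext x
    have ha' := congrArg (fun g => g x) (ha q q' h)
    have hb' := congrArg (fun g => g x) (hb q q' h)
    simp only [LinearMap.comp_apply] at ha' hb' ⊢
    simp only [Pi.add_apply, LinearMap.add_apply, map_add, ha', hb']
  zero_mem' := by
    simp only [Set.mem_setOf_eq]
    intro q q' h
    ext x
    simp
  smul_mem' := by
    intro c a ha
    simp only [Set.mem_setOf_eq] at ha ⊢
    intro q q' h
    ext x
    have ha' := congrArg (fun g => g x) (ha q q' h)
    simp only [LinearMap.comp_apply] at ha' ⊢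
    simp only [Pi.smul_apply, LinearMap.smul_apply, map_smul, ha']

/-- The scalar by which a homomorphism of indicator modules acts in degree `q`. -/
noncomputable def scl {k : Type} [Field k] {Q : Type} {S T : Set Q}
    (φ : ∀ q : Q, ↥(cmpt k S q) →ₗ[k] ↥(cmpt k T q)) (q : Q) (hq : q ∈ S) : k :=
  (φ q ⟨1, by simp [cmpt, hq]⟩ : ↥(cmpt k T q)).1

/-- The set of connected components of a subset `S` of a poset: the quotient of `S`
by the equivalence relation generated by comparability (zigzag paths within `S`). -/
def Pi0 {Q : Type} [PartialOrder Q] (S : Set Q) : Type :=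
  Quot (fun a b : S => (a : Q) ≤ (b : Q))

open Pointwise

/-- `ℤτ ⊆ ℤⁿ`: the subgroup generated by the standard basis vectors indexed by the face
`τ ⊆ {1, …, n}`. -/
def ZTau (n : ℕ) (τ : Set (Fin n)) : Set (Fin n → ℤ) := {z | ∀ i, i ∉ τ → z i = 0}

/-- `ℕⁿ ⊆ ℤⁿ`: the positive cone of componentwise nonnegative vectors. -/
def NNn (n : ℕ) : Set (Fin n → ℤ) := {m | 0 ≤ m}

/-- The upset `a + ℤτ' + ℕⁿ` of `ℤⁿ`. -/
def upFlat {n : ℕ} (a : Fin n → ℤ) (τ' : Set (Fin n)) : Set (Fin n → ℤ) :=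
  ({a} : Set (Fin n → ℤ)) + ZTau n τ' + NNn n

/-- The downset `b + ℤτ − ℕⁿ` of `ℤⁿ`. -/
def downInj {n : ℕ} (b : Fin n → ℤ) (τ : Set (Fin n)) : Set (Fin n → ℤ) :=
  ({b} : Set (Fin n → ℤ)) + ZTau n τ - NNn n

/-- Degree-`q` component of a finite direct sum of upset modules `k[a p + ℤ(τ' p) + ℕⁿ]`. -/
noncomputable abbrev FSum (k : Type) [Field k] {n : ℕ} (m : ℕ)
    (a : Fin m → (Fin n → ℤ)) (τ' : Fin m → Set (Fin n)) (q : Fin n → ℤ) : Type :=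
  ∀ p : Fin m, ↥(cmpt k (upFlat (a p) (τ' p)) q)

/-- Degree-`q` component of a finite direct sum of downset modules `k[b j + ℤ(τ j) − ℕⁿ]`. -/
noncomputable abbrev ESum (k : Type) [Field k] {n : ℕ} (m : ℕ)
    (b : Fin m → (Fin n → ℤ)) (τ : Fin m → Set (Fin n)) (q : Fin n → ℤ) : Type :=
  ∀ j : Fin m, ↥(cmpt k (downInj (b j) (τ j)) q)

/-- Structure map of a finite direct sum of upset modules. -/
noncomputable def FSumMap (k : Type) [Field k] {n : ℕ} (m : ℕ)
    (a : Fin m → (Fin n → ℤ)) (τ' : Fin m → Set (Fin n))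
    {q q' : Fin n → ℤ} (h : q ≤ q') : FSum k m a τ' q →ₗ[k] FSum k m a τ' q' :=
  LinearMap.pi fun p => (stMap k (upFlat (a p) (τ' p)) h) ∘ₗ LinearMap.proj p

/-- Structure map of a finite direct sum of downset modules. -/
noncomputable def ESumMap (k : Type) [Field k] {n : ℕ} (m : ℕ)
    (b : Fin m → (Fin n → ℤ)) (τ : Fin m → Set (Fin n))
    {q q' : Fin n → ℤ} (h : q ≤ q') : ESum k m b τ q →ₗ[k] ESum k m b τ q' :=
  LinearMap.pi fun j => (stMap k (downInj (b j) (τ j)) h) ∘ₗ LinearMap.proj j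

/-- A `ℤⁿ`-module `N` is finitely determined if its components are finite-dimensional and
for each coordinate `i` the structure maps `N_b → N_{b + eᵢ}` are isomorphisms whenever
the `i`-th coordinate of `b` lies outside a bounded interval. -/
def FinDet (k : Type) [Field k] {n : ℕ}
    (N : (Fin n → ℤ) → Type) [∀ a, AddCommGroup (N a)] [∀ a, Module k (N a)]
    (f : ∀ {a b : Fin n → ℤ}, a ≤ b → (N a →ₗ[k] N b)) : Prop :=
  (∀ a, FiniteDimensional k (N a)) ∧
  ∀ i : Fin n, ∃ c : ℤ, ∀ b : Fin n → ℤ, c < |b i| →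
    Function.Bijective
      (f (le_add_of_nonneg_right (Pi.single_nonneg.mpr zero_le_one)) :
        N b →ₗ[k] N (b + Pi.single i 1))

/-- `N` admits a finite flange presentation: a `ℤⁿ`-module homomorphism `φ : F → E` with
image isomorphic to `N`, where `F` is a finite direct sum of upset modules
`k[a + ℤτ' + ℕⁿ]` and `E` is a finite direct sum of downset modules `k[b + ℤτ − ℕⁿ]`. -/
def HasFiniteFlangePresentation (k : Type) [Field k] {n : ℕ}
    (N : (Fin n → ℤ) → Type) [∀ a, AddCommGroup (N a)] [∀ a, Module k (N a)]
    (f : ∀ {a b : Fin n → ℤ}, a ≤ b → (N a →ₗ[k] N b)) : Prop :=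
  ∃ (mF mE : ℕ) (av : Fin mF → (Fin n → ℤ)) (τ'v : Fin mF → Set (Fin n))
    (bv : Fin mE → (Fin n → ℤ)) (τv : Fin mE → Set (Fin n))
    (φ : ∀ q : Fin n → ℤ, FSum k mF av τ'v q →ₗ[k] ESum k mE bv τv q),
    (∀ (q q' : Fin n → ℤ) (h : q ≤ q'),
      ESumMap k mE bv τv h ∘ₗ φ q = φ q' ∘ₗ FSumMap k mF av τ'v h) ∧
    ∃ e : ∀ q : Fin n → ℤ, N q ≃ₗ[k] ↥(LinearMap.range (φ q)),
      ∀ (q q' : Fin n → ℤ) (h : q ≤ q') (x : N q),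
        ((e q' (f h x)) : ESum k mE bv τv q')
          = ESumMap k mE bv τv h ((e q x : ESum k mE bv τv q))

section FlangeDuality

variable {k : Type} [Field k] {n : ℕ}

theorem mem_upFlat {a q : Fin n → ℤ} {τ : Set (Fin n)} :
    q ∈ upFlat a τ ↔ ∀ i, i ∉ τ → a i ≤ q i := by
  constructor
  · rintro ⟨_, ⟨_, rfl, z, hz, rfl⟩, m, hm, rfl⟩ i hi
    have h₁ := hz i hi
    have h₂ : 0 ≤ m i := hm i
    simp only [Pi.add_apply]
    omega
  · classical
    intro h
    refine ⟨_, ⟨a, rfl, fun i => if i ∈ τ then q i - a i else 0, fun i hi => if_neg hi, rfl⟩,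
      fun i => if i ∈ τ then 0 else q i - a i, fun i => ?_, ?_⟩
    · by_cases hi : i ∈ τ
      · simp [hi]
      · simpa [hi] using h i hi
    · funext i
      by_cases hi : i ∈ τ <;> simp [hi]

theorem mem_downInj {b q : Fin n → ℤ} {τ : Set (Fin n)} :
    q ∈ downInj b τ ↔ ∀ i, i ∉ τ → q i ≤ b i := by
  constructor
  · rintro ⟨_, ⟨_, rfl, z, hz, rfl⟩, m, hm, rfl⟩ i hi
    have h₁ := hz i hi
    have h₂ : 0 ≤ m i := hm i
    simp only [Pi.add_apply, Pi.sub_apply]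
    omega
  · classical
    intro h
    refine ⟨_, ⟨b, rfl, fun i => if i ∈ τ then q i - b i else 0, fun i hi => if_neg hi, rfl⟩,
      fun i => if i ∈ τ then 0 else b i - q i, fun i => ?_, ?_⟩
    · by_cases hi : i ∈ τ
      · simp [hi]
      · simpa [hi] using h i hi
    · funext i
      by_cases hi : i ∈ τ <;> simp [hi]

theorem mem_upFlat_neg {b q : Fin n → ℤ} {τ : Set (Fin n)} :
    q ∈ upFlat (-b) τ ↔ -q ∈ downInj b τ := by
  simp only [mem_upFlat, mem_downInj, Pi.neg_apply, neg_le]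

theorem mem_downInj_neg {a q : Fin n → ℤ} {τ : Set (Fin n)} :
    q ∈ downInj (-a) τ ↔ -q ∈ upFlat a τ := by
  simp only [mem_upFlat, mem_downInj, Pi.neg_apply, le_neg]

theorem cmpt_congr {Q Q' : Type} {S : Set Q} {T : Set Q'} {q : Q} {q' : Q'}
    (h : q ∈ S ↔ q' ∈ T) : cmpt k S q = cmpt k T q' := by
  by_cases hq : q ∈ S
  · simp only [cmpt, if_pos hq, if_pos (h.1 hq)]
  · simp only [cmpt, if_neg hq, if_neg (mt h.2 hq)]

theorem eq_zero_of_notMem {Q : Type} {S : Set Q} {q : Q} (h : q ∉ S) (x : cmpt k S q) :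
    (x : k) = 0 := by
  have hx := x.2
  simpa only [cmpt, if_neg h, Submodule.mem_bot] using hx

theorem coe_stMap_of_mem {Q : Type} [PartialOrder Q] {S : Set Q} {q q' : Q} (h : q ≤ q')
    (hq : q ∈ S) (hq' : q' ∈ S) (x : cmpt k S q) : (stMap k S h x : k) = x := by
  simp only [stMap, dif_pos (And.intro hq hq'), Submodule.coe_inclusion]

theorem coe_stMap_of_not {Q : Type} [PartialOrder Q] {S : Set Q} {q q' : Q} (h : q ≤ q')
    (hq : ¬ (q ∈ S ∧ q' ∈ S)) (x : cmpt k S q) : (stMap k S h x : k) = 0 := by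
  simp only [stMap, dif_neg hq, LinearMap.zero_apply, Submodule.coe_zero]

/-- The pairing `(c, x) ↦ ∑ j, c j * x j` between products of subspaces of `k`. -/
noncomputable def sumPairing {m : ℕ} (V W : Fin m → Submodule k k) :
    (∀ j, V j) →ₗ[k] Module.Dual k (∀ j, W j) :=
  LinearMap.mk₂ k (fun c x => ∑ j, (c j : k) * (x j : k))
    (by intros; simp [add_mul, Finset.sum_add_distrib])
    (by intros; simp [Finset.mul_sum, mul_assoc])
    (by intros; simp [mul_add, Finset.sum_add_distrib])
    (by intros; simp [Finset.mul_sum, mul_left_comm])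

theorem sumPairing_apply {m : ℕ} (V W : Fin m → Submodule k k) (c : ∀ j, V j) (x : ∀ j, W j) :
    sumPairing V W c x = ∑ j, (c j : k) * (x j : k) := rfl

theorem sumPairing_bijective {m : ℕ} {V W : Fin m → Submodule k k} (h : V = W) :
    Function.Bijective (sumPairing V W) := by
  subst h
  have hinj : Function.Injective (sumPairing V V) := by
    rw [← LinearMap.ker_eq_bot, LinearMap.ker_eq_bot']
    intro c hc
    funext j
    have h₀ := LinearMap.congr_fun hc (Pi.single j (c j))
    rw [sumPairing_apply, Finset.sum_eq_single j] at h₀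
    · simpa using h₀
    · intro i _ hij
      simp [Pi.single_eq_of_ne hij]
    · simp
  exact ⟨hinj, (LinearMap.injective_iff_surjective_of_finrank_eq_finrank
    Subspace.dual_finrank_eq.symm).1 hinj⟩

/-- The Matlis dual of a finite direct sum of indicator modules `k[S j]` is the direct sum
of the indicator modules of the reflected sets. -/
theorem exists_dual_equiv_indicator {m : ℕ} (S T : Fin m → Set (Fin n → ℤ))
    (hST : ∀ j q, q ∈ T j ↔ -q ∈ S j) :
    ∃ α : ∀ q : Fin n → ℤ,
      Module.Dual k (∀ j, cmpt k (S j) (-q)) ≃ₗ[k] ∀ j, cmpt k (T j) q,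
      ∀ (q q' : Fin n → ℤ) (h : q ≤ q'),
        (α q').toLinearMap ∘ₗ
            (LinearMap.pi fun j => stMap k (S j) (neg_le_neg h) ∘ₗ LinearMap.proj j).dualMap
          = (LinearMap.pi fun j => stMap k (T j) h ∘ₗ LinearMap.proj j) ∘ₗ
            (α q).toLinearMap := by
  let B (q : Fin n → ℤ) : (∀ j, cmpt k (T j) q) ≃ₗ[k] Module.Dual k (∀ j, cmpt k (S j) (-q)) :=
    LinearEquiv.ofBijective (sumPairing (fun j => cmpt k (T j) q) fun j => cmpt k (S j) (-q))
      (sumPairing_bijective (funext fun j => cmpt_congr (hST j q)))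
  refine ⟨fun q => (B q).symm, fun q q' h => LinearMap.ext fun g => ?_⟩
  obtain ⟨c, rfl⟩ := (B q).surjective g
  simp only [LinearMap.comp_apply, LinearEquiv.coe_coe, LinearEquiv.symm_apply_apply]
  rw [LinearEquiv.symm_apply_eq]
  refine LinearMap.ext fun x => ?_
  simp only [B, LinearMap.dualMap_apply, LinearEquiv.ofBijective_apply, sumPairing_apply]
  refine Finset.sum_congr rfl fun j _ => ?_
  simp only [LinearMap.pi_apply, LinearMap.comp_apply, LinearMap.proj_apply]
  by_cases hq : q ∈ T j
  · by_cases hq' : q' ∈ T j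
    · rw [coe_stMap_of_mem h hq hq',
        coe_stMap_of_mem (neg_le_neg h) ((hST j q').1 hq') ((hST j q).1 hq)]
    · rw [eq_zero_of_notMem (mt (hST j q').2 hq') (x j), mul_zero,
        coe_stMap_of_not (neg_le_neg h) fun h' => hq' ((hST j q').2 h'.1), mul_zero]
  · rw [eq_zero_of_notMem hq (c j), zero_mul, coe_stMap_of_not h fun h' => hq h'.1, zero_mul]

theorem exists_dual_equiv_ESum (m : ℕ) (b : Fin m → (Fin n → ℤ)) (τ : Fin m → Set (Fin n)) :
    ∃ α : ∀ q : Fin n → ℤ,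
      Module.Dual k (ESum k m b τ (-q)) ≃ₗ[k] FSum k m (fun j => -(b j)) τ q,
      ∀ (q q' : Fin n → ℤ) (h : q ≤ q'),
        (α q').toLinearMap ∘ₗ (ESumMap k m b τ (neg_le_neg h)).dualMap
          = FSumMap k m (fun j => -(b j)) τ h ∘ₗ (α q).toLinearMap :=
  exists_dual_equiv_indicator (fun j => downInj (b j) (τ j)) (fun j => upFlat (-(b j)) (τ j))
    fun _ _ => mem_upFlat_neg

theorem exists_dual_equiv_FSum (m : ℕ) (a : Fin m → (Fin n → ℤ)) (τ' : Fin m → Set (Fin n)) :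
    ∃ β : ∀ q : Fin n → ℤ,
      Module.Dual k (FSum k m a τ' (-q)) ≃ₗ[k] ESum k m (fun p => -(a p)) τ' q,
      ∀ (q q' : Fin n → ℤ) (h : q ≤ q'),
        (β q').toLinearMap ∘ₗ (FSumMap k m a τ' (neg_le_neg h)).dualMap
          = ESumMap k m (fun p => -(a p)) τ' h ∘ₗ (β q).toLinearMap :=
  exists_dual_equiv_indicator (fun j => upFlat (a j) (τ' j)) (fun j => downInj (-(a j)) (τ' j))
    fun _ _ => mem_downInj_neg

section EpiMono

variable {Q : Type} [Preorder Q]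
  {F N E : Q → Type} [∀ q, AddCommGroup (F q)] [∀ q, Module k (F q)]
  [∀ q, AddCommGroup (N q)] [∀ q, Module k (N q)]
  [∀ q, AddCommGroup (E q)] [∀ q, Module k (E q)]
  {u : ∀ {a b : Q}, a ≤ b → (F a →ₗ[k] F b)}
  {f : ∀ {a b : Q}, a ≤ b → (N a →ₗ[k] N b)}
  {v : ∀ {a b : Q}, a ≤ b → (E a →ₗ[k] E b)}

/-- A homomorphism with image isomorphic to `N` factors as an epimorphism onto `N` followed
by a monomorphism. -/
theorem exists_epi_mono_factorization (φ : ∀ q, F q →ₗ[k] E q)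
    (hφ : ∀ (q q' : Q) (h : q ≤ q'), v h ∘ₗ φ q = φ q' ∘ₗ u h)
    (e : ∀ q, N q ≃ₗ[k] LinearMap.range (φ q))
    (he : ∀ (q q' : Q) (h : q ≤ q') (x : N q), (e q' (f h x) : E q') = v h (e q x)) :
    ∃ (s : ∀ q, F q →ₗ[k] N q) (i : ∀ q, N q →ₗ[k] E q),
      (∀ q, φ q = i q ∘ₗ s q) ∧
      (∀ q, Function.Surjective (s q)) ∧ (∀ q, Function.Injective (i q)) ∧
      (∀ (q q' : Q) (h : q ≤ q'), f h ∘ₗ s q = s q' ∘ₗ u h) ∧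
      (∀ (q q' : Q) (h : q ≤ q'), v h ∘ₗ i q = i q' ∘ₗ f h) := by
  have hi : ∀ q, Function.Injective ((LinearMap.range (φ q)).subtype ∘ₗ (e q).toLinearMap) :=
    fun q => Subtype.val_injective.comp (e q).injective
  have hfac : ∀ q, φ q = ((LinearMap.range (φ q)).subtype ∘ₗ (e q).toLinearMap) ∘ₗ
      ((e q).symm.toLinearMap ∘ₗ (φ q).rangeRestrict) := fun q => by
    ext x
    simp
  have hnat : ∀ (q q' : Q) (h : q ≤ q'),
      v h ∘ₗ ((LinearMap.range (φ q)).subtype ∘ₗ (e q).toLinearMap) =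
        ((LinearMap.range (φ q')).subtype ∘ₗ (e q').toLinearMap) ∘ₗ f h :=
    fun q q' h => LinearMap.ext fun x => (he q q' h x).symm
  refine ⟨_, _, hfac, fun q => (e q).symm.surjective.comp (φ q).surjective_rangeRestrict, hi,
    fun q q' h => LinearMap.ext fun x => hi q' ?_, hnat⟩
  have h₁ := LinearMap.congr_fun (hnat q q' h) (((e q).symm.toLinearMap ∘ₗ (φ q).rangeRestrict) x)
  have h₂ := LinearMap.congr_fun (hφ q q' h) x
  rw [hfac q, hfac q'] at h₂
  exact h₁.symm.trans h₂

/-- The composite of an epimorphism onto `N` and a monomorphism is a homomorphism whose image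
is isomorphic to `N`. -/
theorem exists_range_equiv_of_epi_mono {φ : ∀ q, F q →ₗ[k] E q}
    (s : ∀ q, F q →ₗ[k] N q) (i : ∀ q, N q →ₗ[k] E q) (hφ : ∀ q, φ q = i q ∘ₗ s q)
    (hs : ∀ q, Function.Surjective (s q)) (hi : ∀ q, Function.Injective (i q))
    (hif : ∀ (q q' : Q) (h : q ≤ q'), v h ∘ₗ i q = i q' ∘ₗ f h) :
    ∃ e : ∀ q, N q ≃ₗ[k] LinearMap.range (φ q),
      ∀ (q q' : Q) (h : q ≤ q') (x : N q), (e q' (f h x) : E q') = v h (e q x) :=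
  ⟨fun q => (LinearEquiv.ofInjective (i q) (hi q)).trans <| LinearEquiv.ofEq _ _ <| by
      rw [hφ q, LinearMap.range_comp_of_range_eq_top _ (LinearMap.range_eq_top.2 (hs q))],
    fun q q' h x => (LinearMap.congr_fun (hif q q' h) x).symm⟩

end EpiMono

section Presentation

variable {N : (Fin n → ℤ) → Type} [∀ a, AddCommGroup (N a)] [∀ a, Module k (N a)]
  {f : ∀ {a b : Fin n → ℤ}, a ≤ b → (N a →ₗ[k] N b)}

theorem hasFiniteFlangePresentation_iff_epi_mono :
    HasFiniteFlangePresentation k N (fun {_ _} h => f h) ↔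
      ∃ (mF mE : ℕ) (a : Fin mF → (Fin n → ℤ)) (τ' : Fin mF → Set (Fin n))
        (b : Fin mE → (Fin n → ℤ)) (τ : Fin mE → Set (Fin n))
        (s : ∀ q, FSum k mF a τ' q →ₗ[k] N q) (i : ∀ q, N q →ₗ[k] ESum k mE b τ q),
        (∀ q, Function.Surjective (s q)) ∧ (∀ q, Function.Injective (i q)) ∧
        (∀ (q q' : Fin n → ℤ) (h : q ≤ q'), f h ∘ₗ s q = s q' ∘ₗ FSumMap k mF a τ' h) ∧
        (∀ (q q' : Fin n → ℤ) (h : q ≤ q'), ESumMap k mE b τ h ∘ₗ i q = i q' ∘ₗ f h) := by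
  constructor
  · rintro ⟨mF, mE, a, τ', b, τ, φ, hφ, e, he⟩
    obtain ⟨s, i, -, hs, hi, hfs, hif⟩ := exists_epi_mono_factorization
      (u := FSumMap k mF a τ') (f := f) (v := ESumMap k mE b τ) φ hφ e he
    exact ⟨mF, mE, a, τ', b, τ, s, i, hs, hi, hfs, hif⟩
  · rintro ⟨mF, mE, a, τ', b, τ, s, i, hs, hi, hfs, hif⟩
    refine ⟨mF, mE, a, τ', b, τ, fun q => i q ∘ₗ s q, fun q q' h => ?_,
      exists_range_equiv_of_epi_mono s i (fun _ => rfl) hs hi hif⟩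
    rw [← LinearMap.comp_assoc, hif, LinearMap.comp_assoc, hfs, LinearMap.comp_assoc]

theorem HasFiniteFlangePresentation.dual
    (H : HasFiniteFlangePresentation k N (fun {_ _} h => f h)) :
    HasFiniteFlangePresentation k (fun q => Module.Dual k (N (-q)))
      (fun {_ _} h => (f (neg_le_neg h)).dualMap) := by
  obtain ⟨mF, mE, a, τ', b, τ, s, i, hs, hi, hfs, hif⟩ :=
    hasFiniteFlangePresentation_iff_epi_mono.1 H
  obtain ⟨α, hα⟩ := exists_dual_equiv_ESum (k := k) mE b τ
  obtain ⟨β, hβ⟩ := exists_dual_equiv_FSum (k := k) mF a τ'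
  refine hasFiniteFlangePresentation_iff_epi_mono.2
    ⟨mE, mF, fun j => -(b j), τ, fun p => -(a p), τ',
      fun q => (i (-q)).dualMap ∘ₗ (α q).symm.toLinearMap,
      fun q => (β q).toLinearMap ∘ₗ (s (-q)).dualMap,
      fun q => (LinearMap.dualMap_surjective_of_injective (hi (-q))).comp (α q).symm.surjective,
      fun q => (β q).injective.comp (LinearMap.dualMap_injective_of_surjective (hs (-q))),
      fun q q' h => LinearMap.ext fun c => ?_, fun q q' h => LinearMap.ext fun g => ?_⟩
  · obtain ⟨g, rfl⟩ := (α q).surjective c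
    have h₁ := LinearMap.congr_fun (hα q q' h) g
    simp only [LinearMap.comp_apply, LinearEquiv.coe_coe] at h₁ ⊢
    rw [← h₁, LinearEquiv.symm_apply_apply, LinearEquiv.symm_apply_apply]
    exact (congrArg g.comp (hif _ _ (neg_le_neg h))).symm
  · have h₁ := LinearMap.congr_fun (hβ q q' h) ((s (-q)).dualMap g)
    refine h₁.symm.trans (congrArg (β q') ?_)
    exact (congrArg g.comp (hfs _ _ (neg_le_neg h))).symm

theorem HasFiniteFlangePresentation.congr {M : (Fin n → ℤ) → Type}
    [∀ a, AddCommGroup (M a)] [∀ a, Module k (M a)]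
    {g : ∀ {a b : Fin n → ℤ}, a ≤ b → (M a →ₗ[k] M b)}
    (H : HasFiniteFlangePresentation k N (fun {_ _} h => f h))
    (ψ : ∀ q, N q ≃ₗ[k] M q)
    (hψ : ∀ (q q' : Fin n → ℤ) (h : q ≤ q') (x : N q), g h (ψ q x) = ψ q' (f h x)) :
    HasFiniteFlangePresentation k M (fun {_ _} h => g h) := by
  obtain ⟨mF, mE, a, τ', b, τ, φ, hφ, e, he⟩ := H
  refine ⟨mF, mE, a, τ', b, τ, φ, hφ, fun q => (ψ q).symm.trans (e q), fun q q' h y => ?_⟩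
  obtain ⟨x, rfl⟩ := (ψ q).surjective y
  have hx := he q q' h x
  simpa [hψ] using hx

/-- A degreewise finite-dimensional module is isomorphic to its double Matlis dual. -/
theorem exists_doubleDual_equiv
    (f_id : ∀ a : Fin n → ℤ, f (le_refl a) = LinearMap.id)
    (f_comp : ∀ {a b c : Fin n → ℤ} (h : a ≤ b) (h' : b ≤ c), f h' ∘ₗ f h = f (h.trans h'))
    (hfin : ∀ a : Fin n → ℤ, FiniteDimensional k (N a)) :
    ∃ ψ : ∀ q, Module.Dual k (Module.Dual k (N (- -q))) ≃ₗ[k] N q,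
      ∀ (q q' : Fin n → ℤ) (h : q ≤ q') (x : Module.Dual k (Module.Dual k (N (- -q)))),
        f h (ψ q x) = ψ q' ((f (neg_le_neg (neg_le_neg h))).dualMap.dualMap x) := by
  let ι (q : Fin n → ℤ) : N (- -q) ≃ₗ[k] N q :=
    LinearEquiv.ofLinearMap (f (neg_neg q).le) (f (neg_neg q).ge)
      (by rw [f_comp, f_id]) (by rw [f_comp, f_id])
  refine ⟨fun q => (Module.evalEquiv k (N (- -q))).symm.trans (ι q), fun q q' h x => ?_⟩
  obtain ⟨y, rfl⟩ := (Module.evalEquiv k (N (- -q))).surjective x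
  have h₁ : (f (neg_le_neg (neg_le_neg h))).dualMap.dualMap (Module.evalEquiv k (N (- -q)) y) =
      Module.evalEquiv k (N (- -q')) (f (neg_le_neg (neg_le_neg h)) y) := rfl
  rw [h₁]
  simp only [LinearEquiv.trans_apply, LinearEquiv.symm_apply_apply]
  exact (LinearMap.congr_fun (f_comp (neg_neg q).le h) y).trans
    (LinearMap.congr_fun (f_comp (neg_le_neg (neg_le_neg h)) (neg_neg q').le) y).symm

end Presentation

end FlangeDuality

/-- Let `N` be a `ℤⁿ`-module with finite-dimensional components and let
`φ : F → E` be a finite flange presentation of `N` (`F` a finite direct sum of upset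
modules `k[a + ℤτ' + ℕⁿ]`, `E` a finite direct sum of downset modules `k[b + ℤτ − ℕⁿ]`,
`image φ ≅ N`).  Then the Matlis dual `φ^∨ : E^∨ → F^∨` is a finite flange presentation
of `N^∨`: it is a `ℤⁿ`-module homomorphism, `E^∨` is isomorphic (as a `ℤⁿ`-module) to the
finite direct sum of the upset modules `k[-b + ℤτ + ℕⁿ]`, `F^∨` is isomorphic to the
finite direct sum of the downset modules `k[-a + ℤτ' − ℕⁿ]`, and `image (φ^∨) ≅ N^∨`.
Consequently `N` admits a finite flange presentation if and only if `N^∨` does. -/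
theorem matlis_dual_of_flange_presentation
    (k : Type) [Field k] (n : ℕ)
    (N : (Fin n → ℤ) → Type) [∀ a, AddCommGroup (N a)] [∀ a, Module k (N a)]
    (f : ∀ {a b : Fin n → ℤ}, a ≤ b → (N a →ₗ[k] N b))
    (f_id : ∀ a : Fin n → ℤ, f (le_refl a) = LinearMap.id)
    (f_comp : ∀ {a b c : Fin n → ℤ} (h : a ≤ b) (h' : b ≤ c),
      f h' ∘ₗ f h = f (h.trans h'))
    (hfin : ∀ a : Fin n → ℤ, FiniteDimensional k (N a)) :
    (∀ (mF mE : ℕ) (av : Fin mF → (Fin n → ℤ)) (τ'v : Fin mF → Set (Fin n))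
       (bv : Fin mE → (Fin n → ℤ)) (τv : Fin mE → Set (Fin n))
       (φ : ∀ q : Fin n → ℤ, FSum k mF av τ'v q →ₗ[k] ESum k mE bv τv q),
       (∀ (q q' : Fin n → ℤ) (h : q ≤ q'),
         ESumMap k mE bv τv h ∘ₗ φ q = φ q' ∘ₗ FSumMap k mF av τ'v h) →
       (∃ e : ∀ q : Fin n → ℤ, N q ≃ₗ[k] ↥(LinearMap.range (φ q)),
         ∀ (q q' : Fin n → ℤ) (h : q ≤ q') (x : N q),
           ((e q' (f h x)) : ESum k mE bv τv q')
             = ESumMap k mE bv τv h ((e q x : ESum k mE bv τv q))) →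
       -- (0) φ^∨ is a homomorphism of ℤⁿ-modules E^∨ → F^∨:
       (∀ (q q' : Fin n → ℤ) (h : q ≤ q'),
         (φ (-q')).dualMap ∘ₗ (ESumMap k mE bv τv (neg_le_neg h)).dualMap
           = (FSumMap k mF av τ'v (neg_le_neg h)).dualMap ∘ₗ (φ (-q)).dualMap) ∧
       -- (1) E^∨ is the finite direct sum of upset modules k[-b + ℤτ + ℕⁿ]:
       (∃ α : ∀ q : Fin n → ℤ,
           Module.Dual k (ESum k mE bv τv (-q)) ≃ₗ[k]
             FSum k mE (fun j => -(bv j)) τv q,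
         ∀ (q q' : Fin n → ℤ) (h : q ≤ q'),
           (α q').toLinearMap ∘ₗ (ESumMap k mE bv τv (neg_le_neg h)).dualMap
             = FSumMap k mE (fun j => -(bv j)) τv h ∘ₗ (α q).toLinearMap) ∧
       -- (2) F^∨ is the finite direct sum of downset modules k[-a + ℤτ' − ℕⁿ]:
       (∃ β : ∀ q : Fin n → ℤ,
           Module.Dual k (FSum k mF av τ'v (-q)) ≃ₗ[k]
             ESum k mF (fun p => -(av p)) τ'v q,
         ∀ (q q' : Fin n → ℤ) (h : q ≤ q'),
           (β q').toLinearMap ∘ₗ (FSumMap k mF av τ'v (neg_le_neg h)).dualMap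
             = ESumMap k mF (fun p => -(av p)) τ'v h ∘ₗ (β q).toLinearMap) ∧
       -- (3) the image of φ^∨ is isomorphic to the Matlis dual N^∨ as a ℤⁿ-module:
       (∃ γ : ∀ q : Fin n → ℤ,
           Module.Dual k (N (-q)) ≃ₗ[k] ↥(LinearMap.range ((φ (-q)).dualMap)),
         ∀ (q q' : Fin n → ℤ) (h : q ≤ q') (x : Module.Dual k (N (-q))),
           ((γ q' ((f (neg_le_neg h)).dualMap x)) :
               Module.Dual k (FSum k mF av τ'v (-q')))
             = (FSumMap k mF av τ'v (neg_le_neg h)).dualMap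
               ((γ q x : Module.Dual k (FSum k mF av τ'v (-q)))))) ∧
    -- Consequently N admits a finite flange presentation iff N^∨ does:
    (HasFiniteFlangePresentation k N (fun {a b} h => f h) ↔
      HasFiniteFlangePresentation k (fun q => Module.Dual k (N (-q)))
        (fun {a b} h => (f (neg_le_neg h)).dualMap)) := by
  refine ⟨fun mF mE av τ'v bv τv φ hφ ⟨e, he⟩ => ⟨fun q q' h => ?_,
    exists_dual_equiv_ESum mE bv τv, exists_dual_equiv_FSum mF av τ'v, ?_⟩,
    fun H => H.dual, fun H => ?_⟩
  · exact LinearMap.ext fun g => congrArg g.comp (hφ _ _ (neg_le_neg h))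
  · obtain ⟨s, i, hfac, hs, hi, hfs, -⟩ := exists_epi_mono_factorization
      (u := FSumMap k mF av τ'v) (f := f) (v := ESumMap k mE bv τv) φ hφ e he
    exact exists_range_equiv_of_epi_mono
      (f := fun h => (f (neg_le_neg h)).dualMap)
      (v := fun h => (FSumMap k mF av τ'v (neg_le_neg h)).dualMap)
      (fun q => (i (-q)).dualMap) (fun q => (s (-q)).dualMap)
      (fun q => by rw [hfac (-q), LinearMap.dualMap_comp_dualMap])
      (fun q => LinearMap.dualMap_surjective_of_injective (hi (-q)))
      (fun q => LinearMap.dualMap_injective_of_surjective (hs (-q)))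
      fun q q' h => LinearMap.ext fun g => (congrArg g.comp (hfs _ _ (neg_le_neg h))).symm
  · obtain ⟨ψ, hψ⟩ := exists_doubleDual_equiv f_id f_comp hfin
    exact H.dual.congr ψ hψ
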